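/- Let ι_{a1}, ι_{a2}, ι_{b1}, ι_{b2}, ι_{e1}, ι_{e2} be nonempty finite types and let ρ be a density matrix (not necessarily pure) on the product type ι_{a1} × ι_{a2} × ι_{b1} × ι_{b2} × ι_{e1} × ι_{e2}. Assume: (i) S(ρ^{a1 b2}) ≥ S(ρ^{b1 e1}); (ii) S(ρ^{a2}) = S(ρ^{b2}); (iii) S(ρ^{b1}) ≤ S(ρ^{e1}). Then S(ρ^{b1 b2}) − S(ρ^{a1 b2}) − S(ρ^{a2}) − S(ρ^{e1 e2}) + S(ρ^{b1 e1 e2}) ≤ 0. -/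

import Mathlib

open Matrix ComplexOrder

/-- Von Neumann entropy of a (Hermitian) matrix: `∑ i, negMulLog λᵢ` over its eigenvalues. -/
noncomputable def vnEntropy {ι : Type*} [Fintype ι] [DecidableEq ι] (M : Matrix ι ι ℂ) : ℝ :=
  if h : M.IsHermitian then ∑ i, Real.negMulLog (h.eigenvalues i) else 0

/-- A density matrix: positive semidefinite with unit trace. -/
def IsDensityMatrix {ι : Type*} [Fintype ι] (ρ : Matrix ι ι ℂ) : Prop :=
  ρ.PosSemidef ∧ ρ.trace = 1

section
/- Index types: positions are (a1, a2, b1, b2, e1, e2). -/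
variable {ι1 ι2 ι3 ι4 ι5 ι6 : Type*}
  [Fintype ι1] [Fintype ι2] [Fintype ι3] [Fintype ι4] [Fintype ι5] [Fintype ι6]

local notation "T" => (ι1 × ι2 × ι3 × ι4 × ι5 × ι6)

/-- Reduced density matrix on (a1, b2). -/
noncomputable def redA1B2 (ρ : Matrix T T ℂ) : Matrix (ι1 × ι4) (ι1 × ι4) ℂ :=
  fun p q => ∑ x2 : ι2, ∑ x3 : ι3, ∑ x5 : ι5, ∑ x6 : ι6,
    ρ (p.1, x2, x3, p.2, x5, x6) (q.1, x2, x3, q.2, x5, x6)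

/-- Reduced density matrix on (b1, e1). -/
noncomputable def redB1E1 (ρ : Matrix T T ℂ) : Matrix (ι3 × ι5) (ι3 × ι5) ℂ :=
  fun p q => ∑ x1 : ι1, ∑ x2 : ι2, ∑ x4 : ι4, ∑ x6 : ι6,
    ρ (x1, x2, p.1, x4, p.2, x6) (x1, x2, q.1, x4, q.2, x6)

/-- Reduced density matrix on (a2). -/
noncomputable def redA2 (ρ : Matrix T T ℂ) : Matrix ι2 ι2 ℂ :=
  fun p q => ∑ x1 : ι1, ∑ x3 : ι3, ∑ x4 : ι4, ∑ x5 : ι5, ∑ x6 : ι6,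
    ρ (x1, p, x3, x4, x5, x6) (x1, q, x3, x4, x5, x6)

/-- Reduced density matrix on (b2). -/
noncomputable def redB2 (ρ : Matrix T T ℂ) : Matrix ι4 ι4 ℂ :=
  fun p q => ∑ x1 : ι1, ∑ x2 : ι2, ∑ x3 : ι3, ∑ x5 : ι5, ∑ x6 : ι6,
    ρ (x1, x2, x3, p, x5, x6) (x1, x2, x3, q, x5, x6)

/-- Reduced density matrix on (b1). -/
noncomputable def redB1 (ρ : Matrix T T ℂ) : Matrix ι3 ι3 ℂ :=
  fun p q => ∑ x1 : ι1, ∑ x2 : ι2, ∑ x4 : ι4, ∑ x5 : ι5, ∑ x6 : ι6,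
    ρ (x1, x2, p, x4, x5, x6) (x1, x2, q, x4, x5, x6)

/-- Reduced density matrix on (e1). -/
noncomputable def redE1 (ρ : Matrix T T ℂ) : Matrix ι5 ι5 ℂ :=
  fun p q => ∑ x1 : ι1, ∑ x2 : ι2, ∑ x3 : ι3, ∑ x4 : ι4, ∑ x6 : ι6,
    ρ (x1, x2, x3, x4, p, x6) (x1, x2, x3, x4, q, x6)

/-- Reduced density matrix on (b1, b2). -/
noncomputable def redB1B2 (ρ : Matrix T T ℂ) : Matrix (ι3 × ι4) (ι3 × ι4) ℂ :=
  fun p q => ∑ x1 : ι1, ∑ x2 : ι2, ∑ x5 : ι5, ∑ x6 : ι6,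
    ρ (x1, x2, p.1, p.2, x5, x6) (x1, x2, q.1, q.2, x5, x6)

/-- Reduced density matrix on (e1, e2). -/
noncomputable def redE1E2 (ρ : Matrix T T ℂ) : Matrix (ι5 × ι6) (ι5 × ι6) ℂ :=
  fun p q => ∑ x1 : ι1, ∑ x2 : ι2, ∑ x3 : ι3, ∑ x4 : ι4,
    ρ (x1, x2, x3, x4, p.1, p.2) (x1, x2, x3, x4, q.1, q.2)

/-- Reduced density matrix on (b1, e1, e2). -/
noncomputable def redB1E1E2 (ρ : Matrix T T ℂ) : Matrix (ι3 × ι5 × ι6) (ι3 × ι5 × ι6) ℂ :=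
  fun p q => ∑ x1 : ι1, ∑ x2 : ι2, ∑ x4 : ι4,
    ρ (x1, x2, p.1, x4, p.2.1, p.2.2) (x1, x2, q.1, x4, q.2.1, q.2.2)

end


namespace SSA

set_option linter.unusedSectionVars false

variable {n m : Type*} [Fintype n] [Fintype m] [DecidableEq n] [DecidableEq m]

lemma tr1 (U V y : Matrix n n ℂ) (P : n → ℂ) (hU : Uᴴ * U = 1) :
    ((U * diagonal P * Uᴴ) * (U * y * Vᴴ)).trace
      = ∑ i, ∑ j, P i * y i j * star ((Uᴴ * V) i j) := by
  have : ((U * diagonal P * Uᴴ) * (U * y * Vᴴ)) = U * (diagonal P * (y * Vᴴ)) := by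
    calc _ = U * diagonal P * (Uᴴ * U) * y * Vᴴ := by simp only [Matrix.mul_assoc]
      _ = _ := by rw [hU]; simp only [Matrix.mul_assoc, Matrix.one_mul]
  rw [this, Matrix.trace_mul_comm]
  have h2 : diagonal P * (y * Vᴴ) * U = diagonal P * (y * (Uᴴ * V)ᴴ) := by
    simp [Matrix.mul_assoc]
  rw [h2]
  simp only [Matrix.trace, Matrix.diag, Matrix.diagonal_mul, Matrix.mul_apply (M := y),
    conjTranspose_apply, Finset.mul_sum, mul_assoc]

lemma tr2 (U V y : Matrix n n ℂ) (P : n → ℂ) (hV : Vᴴ * V = 1) :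
    ((V * diagonal P * Vᴴ) * (U * y * Vᴴ)).trace
      = ∑ i, ∑ j, P j * y i j * star ((Uᴴ * V) i j) := by
  have : ((V * diagonal P * Vᴴ) * (U * y * Vᴴ)) = (V * (diagonal P * (Vᴴ * U * y))) * Vᴴ := by
    simp only [Matrix.mul_assoc]
  rw [this, Matrix.trace_mul_comm, ← Matrix.mul_assoc, hV, Matrix.one_mul]
  have h2 : Vᴴ * U = (Uᴴ * V)ᴴ := by simp
  rw [h2, Finset.sum_comm]
  simp only [Matrix.trace, Matrix.diag, Matrix.diagonal_mul, Matrix.mul_apply (N := y),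
    conjTranspose_apply, Finset.mul_sum]
  refine Finset.sum_congr rfl fun i _ => Finset.sum_congr rfl fun j _ => by ring

lemma tr3 (U V y : Matrix n n ℂ) (P : n → ℂ) (hU : Uᴴ * U = 1) (hV : Vᴴ * V = 1) :
    ((U * diagonal P * Uᴴ) * ((U * y * Vᴴ) * (U * y * Vᴴ)ᴴ)).trace
      = ∑ i, ∑ j, P i * (Complex.normSq (y i j) : ℂ) := by
  have : (U * y * Vᴴ) * (U * y * Vᴴ)ᴴ = U * (y * yᴴ) * Uᴴ := by
    calc _ = U * y * (Vᴴ * V) * yᴴ * Uᴴ := by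
            simp only [conjTranspose_mul, conjTranspose_conjTranspose, Matrix.mul_assoc]
      _ = _ := by rw [hV]; simp only [Matrix.mul_assoc, Matrix.one_mul]
  rw [this, tr1 _ _ _ _ hU, hU]
  refine Finset.sum_congr rfl fun i _ => ?_
  simp [Matrix.one_apply, Matrix.mul_apply, Finset.mul_sum, Complex.mul_conj]

lemma tr4 (U V y : Matrix n n ℂ) (P : n → ℂ) (hU : Uᴴ * U = 1) (hV : Vᴴ * V = 1) :
    ((V * diagonal P * Vᴴ) * ((U * y * Vᴴ)ᴴ * (U * y * Vᴴ))).trace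
      = ∑ i, ∑ j, P j * (Complex.normSq (y i j) : ℂ) := by
  have h := tr3 V U yᴴ P hV hU
  have e : V * yᴴ * Uᴴ = (U * y * Vᴴ)ᴴ := by simp [Matrix.mul_assoc]
  rw [e, conjTranspose_conjTranspose] at h
  rw [h, Finset.sum_comm]
  simp

/-- the linear functional whose supremum over `Y` is the quadratic form -/
noncomputable def Phi (ρ σ : Matrix n n ℂ) (s : ℝ) (Y : Matrix n n ℂ) : ℝ :=
  2 * (ρ * Y).trace.re - 2 * (σ * Y).trace.re - s * (ρ * (Y * Yᴴ)).trace.re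
    - (σ * (Yᴴ * Y)).trace.re

/-- `Phi` in coordinates -/
lemma Phi_eq (U V y : Matrix n n ℂ) (p q : n → ℝ) (s : ℝ) (hU : Uᴴ * U = 1) (hV : Vᴴ * V = 1) :
    Phi (U * diagonal (fun i => (p i : ℂ)) * Uᴴ) (V * diagonal (fun i => (q i : ℂ)) * Vᴴ) s
      (U * y * Vᴴ)
    = ∑ i, ∑ j, (2 * (p i - q j) * (y i j * star ((Uᴴ * V) i j)).re
        - (q j + s * p i) * Complex.normSq (y i j)) := by
  rw [Phi, tr1 _ _ _ _ hU, tr2 _ _ _ _ hV, tr3 _ _ _ _ hU hV, tr4 _ _ _ _ hU hV]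
  simp only [Complex.re_sum, Finset.mul_sum, ← Finset.sum_sub_distrib, mul_assoc,
    Complex.re_ofReal_mul, Complex.ofReal_re]
  refine Finset.sum_congr rfl fun i _ => Finset.sum_congr rfl fun j _ => by ring

/-- quadratic form -/
noncomputable def Q (p q : n → ℝ) (W : Matrix n n ℂ) (s : ℝ) : ℝ :=
  ∑ i, ∑ j, Complex.normSq (W i j) * ((p i - q j) ^ 2 / (q j + s * p i))

lemma Phi_le (U V Y : Matrix n n ℂ) (p q : n → ℝ) (s : ℝ) (hs : 0 ≤ s)
    (hp : ∀ i, 0 < p i) (hq : ∀ i, 0 < q i) (hU : Uᴴ * U = 1) (hV : Vᴴ * V = 1) :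
    Phi (U * diagonal (fun i => (p i : ℂ)) * Uᴴ) (V * diagonal (fun i => (q i : ℂ)) * Vᴴ) s Y
      ≤ Q p q (Uᴴ * V) s := by
  have hU' := mul_eq_one_comm.mp hU
  have hV' := mul_eq_one_comm.mp hV
  have hY : Y = U * (Uᴴ * Y * V) * Vᴴ := by
    calc Y = (U * Uᴴ) * Y * (V * Vᴴ) := by rw [hU', hV']; simp
      _ = _ := by simp only [Matrix.mul_assoc]
  rw [hY, Phi_eq _ _ _ _ _ _ hU hV, Q]
  refine Finset.sum_le_sum fun i _ => Finset.sum_le_sum fun j _ => ?_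
  generalize (Uᴴ * Y * V) i j = a
  generalize (Uᴴ * V) i j = b
  have hc : 0 < q j + s * p i := by have := hp i; have := hq j; positivity
  generalize q j + s * p i = c at hc
  generalize p i - q j = d
  rw [mul_div_assoc', le_div_iff₀ hc]
  simp only [Complex.normSq_apply, Complex.mul_re, Complex.star_def, Complex.conj_re,
    Complex.conj_im]
  nlinarith [sq_nonneg (c * a.re - d * b.re), sq_nonneg (c * a.im - d * b.im)]

lemma exists_Phi_eq (U V : Matrix n n ℂ) (p q : n → ℝ) (s : ℝ) (hs : 0 ≤ s)
    (hp : ∀ i, 0 < p i) (hq : ∀ i, 0 < q i) (hU : Uᴴ * U = 1) (hV : Vᴴ * V = 1) :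
    ∃ Y, Phi (U * diagonal (fun i => (p i : ℂ)) * Uᴴ)
      (V * diagonal (fun i => (q i : ℂ)) * Vᴴ) s Y = Q p q (Uᴴ * V) s := by
  refine ⟨U * (Matrix.of fun i j => (((p i - q j) / (q j + s * p i) : ℝ) : ℂ) * (Uᴴ * V) i j) * Vᴴ,
    ?_⟩
  rw [Phi_eq _ _ _ _ _ _ hU hV, Q]
  refine Finset.sum_congr rfl fun i _ => Finset.sum_congr rfl fun j _ => ?_
  have hc : 0 < q j + s * p i := by have := hp i; have := hq j; positivity
  rw [Matrix.of_apply]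
  generalize (Uᴴ * V) i j = w
  rw [mul_assoc (Complex.ofReal _) w, Complex.re_ofReal_mul, Complex.normSq_mul,
    Complex.normSq_ofReal, Complex.star_def, Complex.mul_conj, Complex.ofReal_re]
  field_simp
  ring

/-- relative entropy in coordinates -/
noncomputable def D (p q : n → ℝ) (W : Matrix n n ℂ) : ℝ :=
  ∑ i, ∑ j, Complex.normSq (W i j) *
    (p i * Real.log (p i) - (p i * Real.log (q j) + p i - q j))

noncomputable def G (a b s : ℝ) : ℝ :=
  a * Real.log ((b + s * a) / (1 + s)) + (a - b) / (1 + s)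

lemma G_deriv {a b s : ℝ} (ha : 0 < a) (hb : 0 < b) (hs : 0 ≤ s) :
    HasDerivAt (G a b) ((a - b) ^ 2 / (b + s * a) * ((1 + s) ^ 2)⁻¹) s := by
  have h1 : 0 < 1 + s := by linarith
  have h2 : 0 < b + s * a := by positivity
  have d1 : HasDerivAt (fun s : ℝ => b + s * a) a s := by
    simpa using ((hasDerivAt_id s).mul_const a).const_add b
  have d2 : HasDerivAt (fun s : ℝ => 1 + s) 1 s := (hasDerivAt_id s).const_add 1
  have d3 := ((d1.div d2 h1.ne').log (div_pos h2 h1).ne').const_mul a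
  have d4 := (hasDerivAt_const s (a - b)).div d2 h1.ne'
  refine (d3.add d4).congr_deriv ?_
  simp only [Pi.div_apply]
  field_simp
  ring

lemma G_zero (a b : ℝ) : G a b 0 = a * Real.log b + a - b := by simp [G]; ring

lemma G_tendsto {a b : ℝ} (ha : 0 < a) :
    Filter.Tendsto (G a b) Filter.atTop (nhds (a * Real.log a)) := by
  have h1 : Filter.Tendsto (fun s : ℝ => (1 + s)) Filter.atTop Filter.atTop :=
    Filter.tendsto_atTop_add_const_left _ _ Filter.tendsto_id
  have h2 : Filter.Tendsto (fun s : ℝ => (1 + s)⁻¹) Filter.atTop (nhds 0) := h1.inv_tendsto_atTop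
  have h3 : Filter.Tendsto (fun s : ℝ => (b + s * a) / (1 + s)) Filter.atTop (nhds a) := by
    have : Filter.Tendsto (fun s : ℝ => a + (b - a) * (1 + s)⁻¹) Filter.atTop (nhds (a + (b-a) * 0)) :=
      (h2.const_mul _).const_add _
    rw [mul_zero, add_zero] at this
    refine this.congr' ?_
    filter_upwards [Filter.eventually_gt_atTop 0] with s hs
    field_simp
    ring
  have h4 : Filter.Tendsto (fun s : ℝ => (a - b) / (1 + s)) Filter.atTop (nhds 0) := by
    simpa [div_eq_mul_inv] using h2.const_mul (a - b)
  have h5 := ((h3.log ha.ne').const_mul a).add h4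
  rw [add_zero] at h5
  exact h5

/-- `∑ w G` -/
noncomputable def GG (p q : n → ℝ) (W : Matrix n n ℂ) (s : ℝ) : ℝ :=
  ∑ i, ∑ j, Complex.normSq (W i j) * G (p i) (q j) s

lemma GG_deriv (p q : n → ℝ) (W : Matrix n n ℂ) {s : ℝ} (hp : ∀ i, 0 < p i) (hq : ∀ i, 0 < q i)
    (hs : 0 ≤ s) : HasDerivAt (GG p q W) (Q p q W s * ((1 + s) ^ 2)⁻¹) s := by
  have := HasDerivAt.fun_sum (u := Finset.univ) fun i _ => HasDerivAt.fun_sum (u := Finset.univ)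
    fun j _ => (G_deriv (hp i) (hq j) hs).const_mul (Complex.normSq (W i j))
  refine this.congr_deriv ?_
  simp only [Q, Finset.sum_mul, mul_assoc]

lemma GG_tendsto (p q : n → ℝ) (W : Matrix n n ℂ) (hp : ∀ i, 0 < p i) :
    Filter.Tendsto (fun s => GG p q W s - GG p q W 0) Filter.atTop (nhds (D p q W)) := by
  have : D p q W = (∑ i, ∑ j, Complex.normSq (W i j) * (p i * Real.log (p i))) - GG p q W 0 := by
    simp only [D, GG, G_zero, ← Finset.sum_sub_distrib, mul_sub]
  rw [this]
  refine Filter.Tendsto.sub_const ?_ _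
  exact tendsto_finsetSum _ fun i _ => tendsto_finsetSum _ fun j _ =>
    (G_tendsto (hp i)).const_mul _

theorem D_mono (U V : Matrix n n ℂ) (p q : n → ℝ) (U' V' : Matrix m m ℂ) (p' q' : m → ℝ)
    (hp : ∀ i, 0 < p i) (hq : ∀ i, 0 < q i) (hU : Uᴴ * U = 1) (hV : Vᴴ * V = 1)
    (hp' : ∀ i, 0 < p' i) (hq' : ∀ i, 0 < q' i) (hU' : U'ᴴ * U' = 1) (hV' : V'ᴴ * V' = 1)
    (φ : Matrix m m ℂ → Matrix n n ℂ) (hmul : ∀ X Y, φ (X * Y) = φ X * φ Y)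
    (hstar : ∀ X, φ Xᴴ = (φ X)ᴴ)
    (hρ : ∀ Z, ((U * diagonal (fun i => (p i : ℂ)) * Uᴴ) * φ Z).trace =
      ((U' * diagonal (fun i => (p' i : ℂ)) * U'ᴴ) * Z).trace)
    (hσ : ∀ Z, ((V * diagonal (fun i => (q i : ℂ)) * Vᴴ) * φ Z).trace =
      ((V' * diagonal (fun i => (q' i : ℂ)) * V'ᴴ) * Z).trace) :
    D p' q' (U'ᴴ * V') ≤ D p q (Uᴴ * V) := by
  have hQ : ∀ s, 0 ≤ s → Q p' q' (U'ᴴ * V') s ≤ Q p q (Uᴴ * V) s := by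
    intro s hs
    obtain ⟨Y, hY⟩ := exists_Phi_eq U' V' p' q' s hs hp' hq' hU' hV'
    rw [← hY]
    refine le_trans (le_of_eq ?_) (Phi_le U V (φ Y) p q s hs hp hq hU hV)
    simp only [Phi, ← hstar, ← hmul, hρ, hσ]
  have hmono : MonotoneOn (fun s => GG p q (Uᴴ * V) s - GG p' q' (U'ᴴ * V') s) (Set.Ici 0) := by
    have hd : ∀ s : ℝ, 0 ≤ s → HasDerivAt (fun s => GG p q (Uᴴ * V) s - GG p' q' (U'ᴴ * V') s)
        (Q p q (Uᴴ * V) s * ((1 + s) ^ 2)⁻¹ - Q p' q' (U'ᴴ * V') s * ((1 + s) ^ 2)⁻¹) s :=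
      fun s hs => (GG_deriv p q _ hp hq hs).sub (GG_deriv p' q' _ hp' hq' hs)
    refine monotoneOn_of_deriv_nonneg (convex_Ici 0) ?_ ?_ ?_
    · exact fun s hs => (hd s hs).continuousAt.continuousWithinAt
    · intro s hs
      rw [interior_Ici] at hs
      exact (hd s hs.le).differentiableAt.differentiableWithinAt
    · intro s hs
      rw [interior_Ici] at hs
      rw [(hd s hs.le).deriv, ← sub_mul]
      exact mul_nonneg (sub_nonneg.2 (hQ s hs.le)) (by positivity)
  refine le_of_tendsto_of_tendsto (GG_tendsto p' q' _ hp') (GG_tendsto p q _ hp) ?_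
  filter_upwards [Filter.eventually_ge_atTop 0] with s hs
  have := hmono (Set.mem_Ici.2 le_rfl) (Set.mem_Ici.2 hs) hs
  simp only at this
  linarith

/-- `D` as traces -/
lemma D_eq (U V : Matrix n n ℂ) (p q : n → ℝ) (hU : Uᴴ * U = 1) (hV : Vᴴ * V = 1) :
    D p q (Uᴴ * V) = (∑ i, p i * Real.log (p i))
      - ((U * diagonal (fun i => (p i : ℂ)) * Uᴴ) *
          (V * diagonal (fun i => (Real.log (q i) : ℂ)) * Vᴴ)).trace.re
      - ∑ i, p i + ∑ i, q i := by
  have hU' := mul_eq_one_comm.mp hU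
  have hV' := mul_eq_one_comm.mp hV
  have hW1 : (Uᴴ * V) * (Uᴴ * V)ᴴ = 1 := by
    calc _ = Uᴴ * (V * Vᴴ) * U := by
          simp only [conjTranspose_mul, conjTranspose_conjTranspose, Matrix.mul_assoc]
      _ = _ := by rw [hV']; simp [hU]
  have hW2 : (Uᴴ * V)ᴴ * (Uᴴ * V) = 1 := mul_eq_one_comm.mp hW1
  have hr : ∀ i, ∑ j, Complex.normSq ((Uᴴ * V) i j) = 1 := by
    intro i
    have := congrFun (congrFun hW1 i) i
    simp only [Matrix.mul_apply (N := (Uᴴ * V)ᴴ), conjTranspose_apply, Complex.star_def,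
      Complex.mul_conj, one_apply_eq] at this
    exact_mod_cast this
  have hc : ∀ j, ∑ i, Complex.normSq ((Uᴴ * V) i j) = 1 := by
    intro j
    have := congrFun (congrFun hW2 j) j
    simp only [Matrix.mul_apply (M := (Uᴴ * V)ᴴ), conjTranspose_apply, Complex.star_def,
      ← Complex.normSq_eq_conj_mul_self, one_apply_eq] at this
    exact_mod_cast this
  have e : V * diagonal (fun i => (Real.log (q i) : ℂ)) * Vᴴ
      = U * (Uᴴ * V * diagonal (fun i => (Real.log (q i) : ℂ))) * Vᴴ := by
    simp only [← Matrix.mul_assoc, hU', Matrix.one_mul]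
  rw [e, tr1 _ _ _ _ hU]
  have e1 : ∑ i, p i * Real.log (p i)
      = ∑ i, ∑ j, Complex.normSq ((Uᴴ * V) i j) * (p i * Real.log (p i)) := by
    simp only [← Finset.sum_mul, hr, one_mul]
  have e2 : ∑ i, p i = ∑ i, ∑ j, Complex.normSq ((Uᴴ * V) i j) * p i := by
    simp only [← Finset.sum_mul, hr, one_mul]
  have e3 : ∑ i, q i = ∑ i, ∑ j, Complex.normSq ((Uᴴ * V) i j) * q j := by
    rw [Finset.sum_comm]
    simp only [← Finset.sum_mul, hc, one_mul]
  rw [e1, e2, e3, D]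
  simp only [Complex.re_sum, ← Finset.sum_sub_distrib, ← Finset.sum_add_distrib]
  refine Finset.sum_congr rfl fun i _ => Finset.sum_congr rfl fun j _ => ?_
  rw [Matrix.mul_diagonal]
  generalize (Uᴴ * V) i j = w
  simp only [Complex.normSq_apply, Complex.mul_re, Complex.mul_im, Complex.star_def, Complex.conj_re,
    Complex.conj_im, Complex.ofReal_re, Complex.ofReal_im]
  ring

end SSA

/-! ### Strong subadditivity -/
namespace SSA
open scoped Kronecker
set_option linter.unusedSectionVars false

section
variable {n : Type*} [Fintype n] [DecidableEq n]

/-- unitary diagonalisation of a matrix -/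
def Dec (M U : Matrix n n ℂ) (p : n → ℝ) : Prop :=
  Uᴴ * U = 1 ∧ M = U * diagonal (fun i => (p i : ℂ)) * Uᴴ

lemma Dec.add {M U : Matrix n n ℂ} {p : n → ℝ} (h : Dec M U p) (c : ℝ) :
    Dec (M + (c : ℂ) • (1 : Matrix n n ℂ)) U (fun i => p i + c) := by
  refine ⟨h.1, ?_⟩
  have hU' := mul_eq_one_comm.mp h.1
  have : diagonal (fun i => ((p i + c : ℝ) : ℂ)) = diagonal (fun i => (p i : ℂ))
      + (c : ℂ) • (1 : Matrix n n ℂ) := by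
    ext i j
    by_cases hij : i = j <;> simp [hij]
  rw [this, Matrix.mul_add, Matrix.add_mul, ← h.2]
  simp [hU']

lemma Dec.trace {M U : Matrix n n ℂ} {p : n → ℝ} (h : Dec M U p) :
    M.trace.re = ∑ i, p i := by
  rw [h.2, Matrix.trace_mul_comm, ← Matrix.mul_assoc, h.1, Matrix.one_mul]
  simp [Matrix.trace]

lemma Dec.trace_log {M U : Matrix n n ℂ} {p : n → ℝ} (h : Dec M U p) (r : n → ℝ) :
    (M * (U * diagonal (fun i => (r i : ℂ)) * Uᴴ)).trace.re = ∑ i, p i * r i := by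
  have : M * (U * diagonal (fun i => (r i : ℂ)) * Uᴴ)
      = U * (diagonal (fun i => (p i : ℂ)) * (Uᴴ * U) * diagonal (fun i => (r i : ℂ))) * Uᴴ := by
    rw [h.2]; simp only [Matrix.mul_assoc]
  rw [this, Matrix.trace_mul_comm, ← Matrix.mul_assoc, h.1, Matrix.one_mul, Matrix.mul_one,
    Matrix.diagonal_mul_diagonal]
  simp [Matrix.trace]

lemma dec_eigen {M : Matrix n n ℂ} (h : M.IsHermitian) :
    Dec M (h.eigenvectorUnitary : Matrix n n ℂ) h.eigenvalues := by
  refine ⟨?_, ?_⟩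
  · exact Unitary.coe_star_mul_self h.eigenvectorUnitary
  · conv_lhs => rw [h.spectral_theorem, Unitary.conjStarAlgAut_apply]
    rfl

end

variable {A B C : Type*} [Fintype A] [Fintype B] [Fintype C]
  [DecidableEq A] [DecidableEq B] [DecidableEq C]

/-- trace out the last factor -/
def tC (ρ : Matrix (A × B × C) (A × B × C) ℂ) : Matrix (A × B) (A × B) ℂ :=
  fun x y => ∑ c, ρ (x.1, x.2, c) (y.1, y.2, c)

/-- trace out the first factor -/
def tA {D : Type*} (ρ : Matrix (A × D) (A × D) ℂ) : Matrix D D ℂ :=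
  fun x y => ∑ a, ρ (a, x) (a, y)

/-- the embedding `Z ↦ Z ⊗ 1` -/
def emb (Z : Matrix (A × B) (A × B) ℂ) : Matrix (A × B × C) (A × B × C) ℂ :=
  (Z ⊗ₖ (1 : Matrix C C ℂ)).submatrix (Equiv.prodAssoc A B C).symm (Equiv.prodAssoc A B C).symm

lemma emb_mul (X Y : Matrix (A × B) (A × B) ℂ) :
    emb (C := C) (X * Y) = emb X * emb Y := by
  simp only [emb, Matrix.submatrix_mul_equiv, ← Matrix.mul_kronecker_mul, Matrix.one_mul]

lemma emb_star (X : Matrix (A × B) (A × B) ℂ) :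
    emb (C := C) Xᴴ = (emb X)ᴴ := by
  simp only [emb, Matrix.conjTranspose_submatrix, Matrix.conjTranspose_kronecker,
    Matrix.conjTranspose_one]

lemma trace_emb (ρ : Matrix (A × B × C) (A × B × C) ℂ) (Z : Matrix (A × B) (A × B) ℂ) :
    (ρ * emb Z).trace = (tC ρ * Z).trace := by
  simp only [Matrix.trace, Matrix.diag, Matrix.mul_apply, emb, tC, Fintype.sum_prod_type,
    Matrix.submatrix_apply, Equiv.prodAssoc_symm_apply, Matrix.kroneckerMap_apply,
    Matrix.one_apply, mul_ite, mul_one, mul_zero, Finset.sum_ite_eq', Finset.mem_univ, if_true,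
    Finset.sum_mul]
  refine Finset.sum_congr rfl fun a _ => Finset.sum_congr rfl fun b _ => ?_
  rw [Finset.sum_comm]
  refine Finset.sum_congr rfl fun a' _ => ?_
  rw [Finset.sum_comm]

lemma trace_one_kron {D : Type*} [Fintype D] [DecidableEq D]
    (ρ : Matrix (A × D) (A × D) ℂ) (L : Matrix D D ℂ) :
    (ρ * ((1 : Matrix A A ℂ) ⊗ₖ L)).trace = (tA ρ * L).trace := by
  simp only [Matrix.trace, Matrix.diag, Matrix.mul_apply, tA, Fintype.sum_prod_type,
    Matrix.kroneckerMap_apply, Matrix.one_apply, ite_mul, one_mul, zero_mul, mul_ite, mul_zero,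
    Finset.sum_mul]
  have : ∀ (a : A) (d : D), (∑ a' : A, ∑ d' : D, if a' = a then ρ (a, d) (a', d') * L d' d else 0)
      = ∑ d', ρ (a, d) (a, d') * L d' d := by
    intro a d
    rw [Finset.sum_comm]
    simp
  simp only [this]
  rw [Finset.sum_comm]
  refine Finset.sum_congr rfl fun d _ => ?_
  rw [Finset.sum_comm]

lemma tC_one_kron (τ : Matrix (B × C) (B × C) ℂ) (b' : Matrix B B ℂ)
    (hb : ∀ x y, b' x y = ∑ c, τ (x, c) (y, c)) :
    tC ((1 : Matrix A A ℂ) ⊗ₖ τ) = (1 : Matrix A A ℂ) ⊗ₖ b' := by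
  ext x y
  simp [tC, Matrix.kroneckerMap_apply, hb, Finset.mul_sum]

lemma Dec.kron {D : Type*} [Fintype D] [DecidableEq D] {M U : Matrix D D ℂ} {p : D → ℝ}
    (h : Dec M U p) :
    Dec ((1 : Matrix A A ℂ) ⊗ₖ M) ((1 : Matrix A A ℂ) ⊗ₖ U) (fun x => p x.2) := by
  have hd : diagonal (fun x : A × D => (p x.2 : ℂ))
      = (1 : Matrix A A ℂ) ⊗ₖ diagonal (fun i => (p i : ℂ)) := by
    rw [← Matrix.diagonal_one, Matrix.diagonal_kronecker_diagonal]
    simp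
  refine ⟨?_, ?_⟩
  · rw [Matrix.conjTranspose_kronecker, ← Matrix.mul_kronecker_mul, h.1]
    simp
  · rw [Matrix.conjTranspose_kronecker, hd, ← Matrix.mul_kronecker_mul,
      ← Matrix.mul_kronecker_mul, ← h.2]
    simp

lemma D_cond {D : Type*} [Fintype D] [DecidableEq D] {ρ U : Matrix (A × D) (A × D) ℂ}
    {V : Matrix D D ℂ} {p : A × D → ℝ} {q : D → ℝ} (h : Dec ρ U p) (h' : Dec (tA ρ) V q) :
    SSA.D p (fun x => q x.2) (Uᴴ * ((1 : Matrix A A ℂ) ⊗ₖ V))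
      = (∑ i, p i * Real.log (p i)) - (∑ i, q i * Real.log (q i)) - ρ.trace.re
        + Fintype.card A * ρ.trace.re := by
  have hk := Dec.kron (A := A) h'
  rw [D_eq _ _ _ _ h.1 hk.1, ← h.2]
  have hL : (1 : Matrix A A ℂ) ⊗ₖ V * diagonal (fun i : A × D => (Real.log (q i.2) : ℂ))
      * ((1 : Matrix A A ℂ) ⊗ₖ V)ᴴ
      = (1 : Matrix A A ℂ) ⊗ₖ (V * diagonal (fun i => (Real.log (q i) : ℂ)) * Vᴴ) :=
    (Dec.kron (A := A) (p := fun i => Real.log (q i)) ⟨h'.1, rfl⟩).2.symm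
  have ht : (tA ρ).trace = ρ.trace := by
    simp only [Matrix.trace, Matrix.diag, tA, Fintype.sum_prod_type]
    rw [Finset.sum_comm]
  have hs : ∑ i : A × D, q i.2 = Fintype.card A * ρ.trace.re := by
    rw [Fintype.sum_prod_type]
    simp [← h'.trace, ht]
  rw [hL, trace_one_kron, h'.trace_log, ← h.trace, hs]

/-- strong subadditivity, positive definite case, for arbitrary diagonalisations -/
theorem ssa_core (ρ : Matrix (A × B × C) (A × B × C) ℂ)
    {U : Matrix (A × B × C) (A × B × C) ℂ} {p : A × B × C → ℝ}
    {U' : Matrix (A × B) (A × B) ℂ} {p' : A × B → ℝ}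
    {V : Matrix (B × C) (B × C) ℂ} {q : B × C → ℝ}
    {V' : Matrix B B ℂ} {q' : B → ℝ}
    (h1 : Dec ρ U p) (h2 : Dec (tC ρ) U' p') (h3 : Dec (tA ρ) V q) (h4 : Dec (tA (tC ρ)) V' q')
    (hp : ∀ i, 0 < p i) (hp' : ∀ i, 0 < p' i) (hq : ∀ i, 0 < q i) (hq' : ∀ i, 0 < q' i) :
    (∑ i, p' i * Real.log (p' i)) - (∑ i, q' i * Real.log (q' i))
      ≤ (∑ i, p i * Real.log (p i)) - (∑ i, q i * Real.log (q i)) := by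
  have hk := Dec.kron (A := A) h3
  have hk' := Dec.kron (A := A) h4
  have key := D_mono U ((1 : Matrix A A ℂ) ⊗ₖ V) p (fun x => q x.2)
    U' ((1 : Matrix A A ℂ) ⊗ₖ V') p' (fun x => q' x.2) hp (fun x => hq x.2) h1.1 hk.1
    hp' (fun x => hq' x.2) h2.1 hk'.1 emb emb_mul emb_star
    (fun Z => by rw [← h1.2, ← h2.2, trace_emb])
    (fun Z => by
      rw [← hk.2, ← hk'.2, trace_emb, tC_one_kron (b' := tA (tC ρ))]
      intro x y
      simp only [tA, tC]
      rw [Finset.sum_comm])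
  rw [D_cond h1 h3, D_cond h2 h4] at key
  have ht : (tC ρ).trace = ρ.trace := by
    simp only [Matrix.trace, Matrix.diag, tC, Fintype.sum_prod_type]
  rw [ht] at key
  linarith

lemma tC_add (ρ : Matrix (A × B × C) (A × B × C) ℂ) (c : ℝ) :
    tC (ρ + (c : ℂ) • 1) = tC ρ + ((Fintype.card C * c : ℝ) : ℂ) • 1 := by
  ext x y
  by_cases h : x = y
  · subst h; simp [tC, Finset.sum_add_distrib]
  · have h' : ¬ (x.1 = y.1 ∧ x.2 = y.2) := fun h'' => h (Prod.ext h''.1 h''.2)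
    simp only [not_and] at h'
    simp [tC, Finset.sum_add_distrib, Matrix.one_apply, h]
    exact fun a b => absurd b (h' a)

lemma tA_add {D : Type*} [Fintype D] [DecidableEq D] (ρ : Matrix (A × D) (A × D) ℂ) (c : ℝ) :
    tA (ρ + (c : ℂ) • 1) = tA ρ + ((Fintype.card A * c : ℝ) : ℂ) • 1 := by
  ext x y
  by_cases h : x = y
  · subst h; simp [tA, Finset.sum_add_distrib]
  · simp [tA, Finset.sum_add_distrib, Matrix.one_apply, h]

lemma tC_psd {ρ : Matrix (A × B × C) (A × B × C) ℂ} (h : ρ.PosSemidef) : (tC ρ).PosSemidef := by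
  have : tC ρ = ∑ c, ρ.submatrix (fun x : A × B => (x.1, x.2, c)) (fun x => (x.1, x.2, c)) := by
    ext x y
    simp [tC, Matrix.sum_apply]
  rw [this]
  exact Matrix.posSemidef_sum _ fun c _ => h.submatrix _

lemma tA_psd {D : Type*} [Fintype D] [DecidableEq D] {ρ : Matrix (A × D) (A × D) ℂ}
    (h : ρ.PosSemidef) : (tA ρ).PosSemidef := by
  have : tA ρ = ∑ a, ρ.submatrix (fun x : D => (a, x)) (fun x => (a, x)) := by
    ext x y
    simp [tA, Matrix.sum_apply]
  rw [this]
  exact Matrix.posSemidef_sum _ fun c _ => h.submatrix _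

lemma tend {n : Type*} [Fintype n] (p : n → ℝ) (k : ℝ) :
    Filter.Tendsto (fun ε : ℝ => ∑ i, (p i + k * ε) * Real.log (p i + k * ε))
      (nhdsWithin 0 (Set.Ioi 0)) (nhds (∑ i, p i * Real.log (p i))) := by
  have hc : Continuous (fun ε : ℝ => ∑ i, (p i + k * ε) * Real.log (p i + k * ε)) :=
    continuous_finsetSum _ fun i _ =>
      Real.continuous_mul_log.comp (f := fun ε : ℝ => p i + k * ε) (by fun_prop)
  have := (hc.tendsto 0).mono_left (nhdsWithin_le_nhds (s := Set.Ioi 0))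
  simpa using this

/-- strong subadditivity -/
theorem ssa [Nonempty A] [Nonempty B] [Nonempty C] (ρ : Matrix (A × B × C) (A × B × C) ℂ)
    (hρ : ρ.PosSemidef) :
    vnEntropy ρ + vnEntropy (tA (tC ρ)) ≤ vnEntropy (tC ρ) + vnEntropy (tA ρ) := by
  have hC := tC_psd hρ
  have hA := tA_psd hρ
  have hAC := tA_psd hC
  have ea : vnEntropy ρ = - ∑ i, hρ.1.eigenvalues i * Real.log (hρ.1.eigenvalues i) := by
    rw [vnEntropy, dif_pos hρ.1]; simp [Real.negMulLog]
  have eb : vnEntropy (tC ρ) = - ∑ i, hC.1.eigenvalues i * Real.log (hC.1.eigenvalues i) := by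
    rw [vnEntropy, dif_pos hC.1]; simp [Real.negMulLog]
  have ec : vnEntropy (tA ρ) = - ∑ i, hA.1.eigenvalues i * Real.log (hA.1.eigenvalues i) := by
    rw [vnEntropy, dif_pos hA.1]; simp [Real.negMulLog]
  have ed : vnEntropy (tA (tC ρ))
      = - ∑ i, hAC.1.eigenvalues i * Real.log (hAC.1.eigenvalues i) := by
    rw [vnEntropy, dif_pos hAC.1]; simp [Real.negMulLog]
  rw [ea, eb, ec, ed]
  suffices h : (∑ i, hC.1.eigenvalues i * Real.log (hC.1.eigenvalues i))
      - (∑ i, hAC.1.eigenvalues i * Real.log (hAC.1.eigenvalues i))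
      ≤ (∑ i, hρ.1.eigenvalues i * Real.log (hρ.1.eigenvalues i))
      - (∑ i, hA.1.eigenvalues i * Real.log (hA.1.eigenvalues i)) by linarith
  refine le_of_tendsto_of_tendsto
    ((tend hC.1.eigenvalues (Fintype.card C)).sub
      (tend hAC.1.eigenvalues (Fintype.card A * Fintype.card C)))
    ((tend hρ.1.eigenvalues 1).sub (tend hA.1.eigenvalues (Fintype.card A))) ?_
  filter_upwards [self_mem_nhdsWithin] with ε hε
  have hε : 0 < ε := hε
  have cA : (0 : ℝ) < Fintype.card A := by exact_mod_cast Fintype.card_pos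
  have cC : (0 : ℝ) < Fintype.card C := by exact_mod_cast Fintype.card_pos
  have d1 := (dec_eigen hρ.1).add (1 * ε)
  have d2 := (dec_eigen hC.1).add (Fintype.card C * ε)
  have d3 := (dec_eigen hA.1).add (Fintype.card A * ε)
  have d4 := (dec_eigen hAC.1).add (Fintype.card A * Fintype.card C * ε)
  have t2 := tC_add ρ (1 * ε)
  have t3 := tA_add ρ (1 * ε)
  have t4 := tA_add (tC ρ) (Fintype.card C * ε)
  rw [one_mul] at t2 t3
  rw [← t2] at d2 t4
  rw [← t3] at d3
  rw [mul_assoc, ← t4] at d4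
  rw [one_mul] at d1
  have := ssa_core _ d1 d2 d3 d4
    (fun i => add_pos_of_nonneg_of_pos (hρ.eigenvalues_nonneg i) (by positivity))
    (fun i => add_pos_of_nonneg_of_pos (hC.eigenvalues_nonneg i) (by positivity))
    (fun i => add_pos_of_nonneg_of_pos (hA.eigenvalues_nonneg i) (by positivity))
    (fun i => add_pos_of_nonneg_of_pos (hAC.eigenvalues_nonneg i) (by positivity))
  simpa only [one_mul, mul_assoc] using this

lemma vn_reindex {n m : Type*} [Fintype n] [DecidableEq n] [Fintype m] [DecidableEq m]
    (e : m ≃ n) {M : Matrix n n ℂ} (h : M.IsHermitian) :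
    vnEntropy (M.submatrix e e) = vnEntropy M := by
  have h' : (M.submatrix e e).IsHermitian := h.submatrix e
  rw [vnEntropy, dif_pos h', vnEntropy, dif_pos h]
  have hc : (M.submatrix e e).charpoly = M.charpoly := Matrix.charpoly_reindex e.symm M
  have h1 := h'.roots_charpoly_eq_eigenvalues
  have h2 := h.roots_charpoly_eq_eigenvalues
  rw [hc, h2] at h1
  have h3 := congrArg (fun s => (s.map (fun z : ℂ => Real.negMulLog z.re)).sum) h1
  simp only [Multiset.map_map] at h3
  exact h3.symm

lemma vn_unit {M : Matrix Unit Unit ℂ} (h : M.IsHermitian) (ht : M.trace = 1) :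
    vnEntropy M = 0 := by
  rw [vnEntropy, dif_pos h]
  have := (dec_eigen h).trace
  rw [ht] at this
  simp at this
  simp [← this]

/-- subadditivity -/
theorem subadd [Nonempty A] [Nonempty C] (ρ : Matrix (A × C) (A × C) ℂ)
    (hρ : ρ.PosSemidef) (ht : ρ.trace = 1) :
    vnEntropy ρ ≤ vnEntropy (fun x y : A => ∑ c, ρ (x, c) (y, c)) + vnEntropy (tA ρ) := by
  let e : A × Unit × C ≃ A × C := (Equiv.refl A).prodCongr (Equiv.punitProd C)
  let e1 : A × Unit ≃ A := Equiv.prodPUnit A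
  let e2 : Unit × C ≃ C := Equiv.punitProd C
  let R := ρ.submatrix e e
  have hR : R.PosSemidef := hρ.submatrix e
  have h := ssa R hR
  have i1 : R = ρ.submatrix e e := rfl
  have i2 : tC R = Matrix.submatrix (fun x y : A => ∑ c, ρ (x, c) (y, c)) e1 e1 := rfl
  have i3 : tA R = (tA ρ).submatrix e2 e2 := rfl
  have hH : Matrix.IsHermitian (fun x y : A => ∑ c, ρ (x, c) (y, c)) := by
    have := (tC_psd hR).1.submatrix e1.symm
    exact this
  have h4 : vnEntropy (tA (tC R)) = 0 := by
    apply vn_unit (tA_psd (tC_psd hR)).1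
    rw [← ht]
    simp [Matrix.trace, Fintype.sum_prod_type, tA, tC, R, e]
  rw [h4, i2, i3, i1, vn_reindex e hρ.1, vn_reindex e1 hH, vn_reindex e2 (tA_psd hρ).1] at h
  linarith

end SSA

/-- **Second (estimation) stage of the proof of Theorem 2 of the paper.** For a density matrix
`ρ` on `a1 × a2 × b1 × b2 × e1 × e2` with (i) `S(ρ^{a1 b2}) ≥ S(ρ^{b1 e1})`,
(ii) `S(ρ^{a2}) = S(ρ^{b2})`, and (iii) `S(ρ^{b1}) ≤ S(ρ^{e1})`, one has
`S(ρ^{b1 b2}) − S(ρ^{a1 b2}) − S(ρ^{a2}) − S(ρ^{e1 e2}) + S(ρ^{b1 e1 e2}) ≤ 0`. -/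
theorem entropy_estimation_stage
    {ι1 ι2 ι3 ι4 ι5 ι6 : Type*}
    [Fintype ι1] [Fintype ι2] [Fintype ι3] [Fintype ι4] [Fintype ι5] [Fintype ι6]
    [DecidableEq ι1] [DecidableEq ι2] [DecidableEq ι3] [DecidableEq ι4]
    [DecidableEq ι5] [DecidableEq ι6]
    [Nonempty ι1] [Nonempty ι2] [Nonempty ι3] [Nonempty ι4] [Nonempty ι5] [Nonempty ι6]
    (ρ : Matrix (ι1 × ι2 × ι3 × ι4 × ι5 × ι6) (ι1 × ι2 × ι3 × ι4 × ι5 × ι6) ℂ)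
    (hρ : IsDensityMatrix ρ)
    (h1 : vnEntropy (redB1E1 ρ) ≤ vnEntropy (redA1B2 ρ))
    (h2 : vnEntropy (redA2 ρ) = vnEntropy (redB2 ρ))
    (h3 : vnEntropy (redB1 ρ) ≤ vnEntropy (redE1 ρ)) :
    vnEntropy (redB1B2 ρ) - vnEntropy (redA1B2 ρ) - vnEntropy (redA2 ρ)
      - vnEntropy (redE1E2 ρ) + vnEntropy (redB1E1E2 ρ) ≤ 0 := by
  have hp := hρ.1
  have p1 : (redB1E1E2 ρ).PosSemidef := by
    have : redB1E1E2 ρ = ∑ x1 : ι1, ∑ x2 : ι2, ∑ x4 : ι4,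
        ρ.submatrix (fun p : ι3 × ι5 × ι6 => (x1, x2, p.1, x4, p.2.1, p.2.2))
          (fun p => (x1, x2, p.1, x4, p.2.1, p.2.2)) := by
      ext p q
      simp [redB1E1E2, Matrix.sum_apply]
    rw [this]
    exact Matrix.posSemidef_sum _ fun _ _ => Matrix.posSemidef_sum _ fun _ _ =>
      Matrix.posSemidef_sum _ fun _ _ => hp.submatrix _
  have p2 : (redB1B2 ρ).PosSemidef := by
    have : redB1B2 ρ = ∑ x1 : ι1, ∑ x2 : ι2, ∑ x5 : ι5, ∑ x6 : ι6,
        ρ.submatrix (fun p : ι3 × ι4 => (x1, x2, p.1, p.2, x5, x6))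
          (fun p => (x1, x2, p.1, p.2, x5, x6)) := by
      ext p q
      simp [redB1B2, Matrix.sum_apply]
    rw [this]
    exact Matrix.posSemidef_sum _ fun _ _ => Matrix.posSemidef_sum _ fun _ _ =>
      Matrix.posSemidef_sum _ fun _ _ => Matrix.posSemidef_sum _ fun _ _ => hp.submatrix _
  have t2 : (redB1B2 ρ).trace = 1 := by
    rw [← hρ.2]
    simp only [Matrix.trace, Matrix.diag, redB1B2, Fintype.sum_prod_type]
    simp only [← Fintype.sum_prod_type']
    refine Fintype.sum_equiv
      ⟨fun x => (x.2.2.1, x.2.2.2.1, x.1, x.2.1, x.2.2.2.2.1, x.2.2.2.2.2),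
       fun x => (x.2.2.1, x.2.2.2.1, x.1, x.2.1, x.2.2.2.2.1, x.2.2.2.2.2),
       fun _ => rfl, fun _ => rfl⟩ _ _ (fun x => rfl)
  have s1 := SSA.ssa (redB1E1E2 ρ) p1
  have s2 := SSA.subadd (redB1B2 ρ) p2 t2
  have e1 : SSA.tC (redB1E1E2 ρ) = redB1E1 ρ := by
    ext p q
    simp only [SSA.tC, redB1E1E2, redB1E1]
    simp only [← Fintype.sum_prod_type']
    exact Fintype.sum_equiv
      ⟨fun x => (x.2.1, x.2.2.1, x.2.2.2, x.1), fun x => (x.2.2.2, x.1, x.2.1, x.2.2.1),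
       fun _ => rfl, fun _ => rfl⟩ _ _ (fun x => rfl)
  have e2 : SSA.tA (redB1E1E2 ρ) = redE1E2 ρ := by
    ext p q
    simp only [SSA.tA, redB1E1E2, redE1E2]
    simp only [← Fintype.sum_prod_type']
    exact Fintype.sum_equiv
      ⟨fun x => (x.2.1, x.2.2.1, x.1, x.2.2.2), fun x => (x.2.2.1, x.1, x.2.1, x.2.2.2),
       fun _ => rfl, fun _ => rfl⟩ _ _ (fun x => rfl)
  have e3 : SSA.tA (SSA.tC (redB1E1E2 ρ)) = redE1 ρ := by
    rw [e1]
    ext p q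
    simp only [SSA.tA, redB1E1, redE1]
    simp only [← Fintype.sum_prod_type']
    exact Fintype.sum_equiv
      ⟨fun x => (x.2.1, x.2.2.1, x.1, x.2.2.2), fun x => (x.2.2.1, x.1, x.2.1, x.2.2.2),
       fun _ => rfl, fun _ => rfl⟩ _ _ (fun x => rfl)
  have e4 : SSA.tA (redB1B2 ρ) = redB2 ρ := by
    ext p q
    simp only [SSA.tA, redB1B2, redB2]
    simp only [← Fintype.sum_prod_type']
    exact Fintype.sum_equiv
      ⟨fun x => (x.2.1, x.2.2.1, x.1, x.2.2.2), fun x => (x.2.2.1, x.1, x.2.1, x.2.2.2),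
       fun _ => rfl, fun _ => rfl⟩ _ _ (fun x => rfl)
  have e5 : (fun x y : ι3 => ∑ c, redB1B2 ρ (x, c) (y, c)) = redB1 ρ := by
    ext p q
    simp only [redB1B2, redB1]
    simp only [← Fintype.sum_prod_type']
    exact Fintype.sum_equiv
      ⟨fun x => (x.2.1, x.2.2.1, x.1, x.2.2.2), fun x => (x.2.2.1, x.1, x.2.1, x.2.2.2),
       fun _ => rfl, fun _ => rfl⟩ _ _ (fun x => rfl)
  rw [e3, e2, e1] at s1
  rw [e4, e5] at s2
  linarith
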